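/- arXiv:1910.01069 — 5 statements merged into one kernel-verified Lean document; each statement's English description precedes it below -/
import Mathlib

section
/- Let A be an n×n complex matrix with n ≥ 1 and let γ ∈ [0,1). Then the set {z ∈ ℂ : Re z > 0 and σ_min(z·I − A) = γ·Re z} is bounded. Moreover, if every eigenvalue of A has strictly negative real part, then this set is compact. -/
open Matrix

/-- The smallest singular value of a square complex matrix: the infimum of `‖G v‖`
over unit vectors `v` (Euclidean norms). -/
noncomputable def sigmaMin {n : ℕ} (G : Matrix (Fin n) (Fin n) ℂ) : ℝ :=
  sInf {x : ℝ | ∃ v : EuclideanSpace ℂ (Fin n), ‖v‖ = 1 ∧ x = ‖Matrix.toEuclideanLin G v‖}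

theorem sigmaMin_le {n : ℕ} (G : Matrix (Fin n) (Fin n) ℂ) {v : EuclideanSpace ℂ (Fin n)}
    (hv : ‖v‖ = 1) : sigmaMin G ≤ ‖Matrix.toEuclideanLin G v‖ := by
  refine csInf_le ⟨0, ?_⟩ ⟨v, hv, rfl⟩
  rintro x ⟨v, -, rfl⟩
  exact norm_nonneg _

/-- The infimum defining the smallest singular value is attained. -/
theorem exists_norm_eq_sigmaMin {n : ℕ} (hn : 1 ≤ n) (G : Matrix (Fin n) (Fin n) ℂ) :
    ∃ v : EuclideanSpace ℂ (Fin n), ‖v‖ = 1 ∧ sigmaMin G = ‖Matrix.toEuclideanLin G v‖ := by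
  have : Nonempty (Fin n) := ⟨⟨0, hn⟩⟩
  have hne : (Metric.sphere (0 : EuclideanSpace ℂ (Fin n)) 1).Nonempty :=
    NormedSpace.sphere_nonempty.2 zero_le_one
  have hcont : Continuous fun v => ‖Matrix.toEuclideanLin G v‖ :=
    (LinearMap.continuous_of_finiteDimensional _).norm
  obtain ⟨v, hv, hmin⟩ :=
    (isCompact_sphere (0 : EuclideanSpace ℂ (Fin n)) 1).exists_isMinOn hne hcont.continuousOn
  rw [mem_sphere_zero_iff_norm] at hv
  refine ⟨v, hv, (sigmaMin_le G hv).antisymm (le_csInf ⟨_, v, hv, rfl⟩ ?_)⟩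
  rintro x ⟨w, hw, rfl⟩
  exact hmin (mem_sphere_zero_iff_norm.2 hw)

theorem toEuclideanLin_smul_one_sub {n : ℕ} (A : Matrix (Fin n) (Fin n) ℂ) (z : ℂ)
    (v : EuclideanSpace ℂ (Fin n)) :
    Matrix.toEuclideanLin (z • (1 : Matrix (Fin n) (Fin n) ℂ) - A) v =
      z • v - Matrix.toEuclideanLin A v := by
  ext i
  simp [Matrix.toLpLin_apply]

theorem lipschitzWith_sigmaMin_smul_one_sub {n : ℕ} (hn : 1 ≤ n)
    (A : Matrix (Fin n) (Fin n) ℂ) :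
    LipschitzWith 1 fun z : ℂ => sigmaMin (z • (1 : Matrix (Fin n) (Fin n) ℂ) - A) := by
  refine LipschitzWith.of_le_add fun z w => ?_
  obtain ⟨v, hv, h⟩ := exists_norm_eq_sigmaMin hn (w • (1 : Matrix (Fin n) (Fin n) ℂ) - A)
  have hz := sigmaMin_le (z • (1 : Matrix (Fin n) (Fin n) ℂ) - A) hv
  rw [toEuclideanLin_smul_one_sub] at h hz
  have hsplit : z • v - Matrix.toEuclideanLin A v =
      (w • v - Matrix.toEuclideanLin A v) + (z - w) • v := by
    rw [sub_smul]; abel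
  have htri := norm_add_le (w • v - Matrix.toEuclideanLin A v) ((z - w) • v)
  rw [← hsplit, norm_smul, hv, mul_one, ← dist_eq_norm z w] at htri
  linarith

theorem exists_norm_sub_le_sigmaMin {n : ℕ} (hn : 1 ≤ n) (A : Matrix (Fin n) (Fin n) ℂ) :
    ∃ C : ℝ, ∀ z : ℂ, ‖z‖ - C ≤ sigmaMin (z • (1 : Matrix (Fin n) (Fin n) ℂ) - A) := by
  refine ⟨‖(Matrix.toEuclideanLin A).toContinuousLinearMap‖, fun z => ?_⟩
  obtain ⟨v, hv, h⟩ := exists_norm_eq_sigmaMin hn (z • (1 : Matrix (Fin n) (Fin n) ℂ) - A)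
  have hA := (Matrix.toEuclideanLin A).toContinuousLinearMap.le_opNorm v
  have htri := norm_sub_norm_le (z • v) (Matrix.toEuclideanLin A v)
  rw [norm_smul, hv, mul_one] at htri
  rw [hv, mul_one, LinearMap.coe_toContinuousLinearMap'] at hA
  rw [h, toEuclideanLin_smul_one_sub]
  linarith

theorem det_eq_zero_of_sigmaMin_eq_zero {n : ℕ} (hn : 1 ≤ n) {G : Matrix (Fin n) (Fin n) ℂ}
    (hG : sigmaMin G = 0) : G.det = 0 := by
  obtain ⟨v, hv, h⟩ := exists_norm_eq_sigmaMin hn G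
  rw [hG, eq_comm, norm_eq_zero, Matrix.toLpLin_apply] at h
  refine Matrix.exists_mulVec_eq_zero_iff.1 ⟨WithLp.ofLp v, fun h0 => ?_, by simpa using h⟩
  have : v = 0 := by simpa using h0
  simp [this] at hv

theorem stmt1 {n : ℕ} (hn : 1 ≤ n) (A : Matrix (Fin n) (Fin n) ℂ) (γ : ℝ)
    (hγ0 : 0 ≤ γ) (hγ1 : γ < 1) :
    Bornology.IsBounded
      {z : ℂ | 0 < z.re ∧
        sigmaMin (z • (1 : Matrix (Fin n) (Fin n) ℂ) - A) = γ * z.re} ∧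
    ((∀ μ : ℂ, (A - μ • (1 : Matrix (Fin n) (Fin n) ℂ)).det = 0 → μ.re < 0) →
      IsCompact
        {z : ℂ | 0 < z.re ∧
          sigmaMin (z • (1 : Matrix (Fin n) (Fin n) ℂ) - A) = γ * z.re}) := by
  have hbdd : Bornology.IsBounded {z : ℂ | 0 < z.re ∧
      sigmaMin (z • (1 : Matrix (Fin n) (Fin n) ℂ) - A) = γ * z.re} := by
    obtain ⟨C, hC⟩ := exists_norm_sub_le_sigmaMin hn A
    refine isBounded_iff_forall_norm_le.2 ⟨C / (1 - γ), fun z hz => ?_⟩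
    rw [le_div_iff₀ (sub_pos.2 hγ1)]
    have hre := mul_le_mul_of_nonneg_left (Complex.re_le_norm z) hγ0
    linarith [hC z, hz.2]
  refine ⟨hbdd, fun hspec => Metric.isCompact_of_isClosed_isBounded ?_ hbdd⟩
  have hclosed : IsClosed {z : ℂ | 0 ≤ z.re ∧
      sigmaMin (z • (1 : Matrix (Fin n) (Fin n) ℂ) - A) = γ * z.re} :=
    (isClosed_le continuous_const Complex.continuous_re).inter
      (isClosed_eq (lipschitzWith_sigmaMin_smul_one_sub hn A).continuous
        (continuous_const.mul Complex.continuous_re))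
  convert hclosed using 1
  ext z
  refine ⟨fun hz => ⟨hz.1.le, hz.2⟩, fun hz => ⟨hz.1.lt_of_ne fun h0 => ?_, hz.2⟩⟩
  have hdet := det_eq_zero_of_sigmaMin_eq_zero hn (hz.2.trans (by rw [← h0, mul_zero]))
  refine (hspec z ?_).ne h0.symm
  rw [← neg_sub, Matrix.det_neg, hdet, mul_zero]
end

section
/- Let A be an n×n complex matrix and γ, θ ∈ ℝ with |γ·cos θ| ≠ 1. Then N_θ is invertible and N_θ⁻¹·M = (i/(1 − (γ·cos θ)²))·[[e^{−iθ}·A, (γ·cos θ)·Aᴴ],[(γ·cos θ)·A, e^{iθ}·Aᴴ]]; in particular, the spectrum of the matrix pencil (M, N_θ) equals the spectrum of this matrix. -/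
open Matrix

/-- `M = [[A, 0],[0, −Aᴴ]]`. -/
noncomputable def Mmat {n : ℕ} (A : Matrix (Fin n) (Fin n) ℂ) :
    Matrix (Fin n ⊕ Fin n) (Fin n ⊕ Fin n) ℂ :=
  Matrix.fromBlocks A 0 0 (-Aᴴ)

/-- `N_θ = [[−i·e^{iθ}·I, i·γ·cos θ·I],[−i·γ·cos θ·I, i·e^{−iθ}·I]]`. -/
noncomputable def Nmat (n : ℕ) (γ θ : ℝ) :
    Matrix (Fin n ⊕ Fin n) (Fin n ⊕ Fin n) ℂ :=
  Matrix.fromBlocks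
    ((-(Complex.I * Complex.exp (Complex.I * (θ : ℂ)))) • (1 : Matrix (Fin n) (Fin n) ℂ))
    ((Complex.I * ((γ * Real.cos θ : ℝ) : ℂ)) • (1 : Matrix (Fin n) (Fin n) ℂ))
    ((-(Complex.I * ((γ * Real.cos θ : ℝ) : ℂ))) • (1 : Matrix (Fin n) (Fin n) ℂ))
    ((Complex.I * Complex.exp (-(Complex.I * (θ : ℂ)))) • (1 : Matrix (Fin n) (Fin n) ℂ))

theorem fromBlocks_smul_one_mul_adjugate {n R : Type*} [Fintype n] [DecidableEq n] [CommRing R]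
    (a b c d : R) :
    (fromBlocks (a • (1 : Matrix n n R)) (b • 1) (c • 1) (d • 1)) *
      fromBlocks (d • (1 : Matrix n n R)) ((-b) • 1) ((-c) • 1) (a • 1) =
        (a * d - b * c) • (1 : Matrix (n ⊕ n) (n ⊕ n) R) := by
  rw [fromBlocks_multiply, ← fromBlocks_one, fromBlocks_smul]
  simp only [smul_mul_smul_comm, mul_one, ← add_smul, smul_zero]
  congr 1
  · congr 1; ring
  · rw [show a * -b + b * a = 0 by ring, zero_smul]
  · rw [show c * d + d * -c = 0 by ring, zero_smul]
  · congr 1; ring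

theorem det_sub_smul_eq_zero_iff_of_isUnit {n K : Type*} [Fintype n] [DecidableEq n] [Field K]
    {N : Matrix n n K} (hN : IsUnit N) (M : Matrix n n K) (lam : K) :
    (M - lam • N).det = 0 ↔ (N⁻¹ * M - lam • (1 : Matrix n n K)).det = 0 := by
  have hdet : IsUnit N.det := (isUnit_iff_isUnit_det N).1 hN
  have hfactor : M - lam • N = N * (N⁻¹ * M - lam • (1 : Matrix n n K)) := by
    rw [mul_sub, mul_nonsing_inv_cancel_left _ _ hdet, mul_smul_comm, mul_one]
  rw [hfactor, det_mul, mul_eq_zero, or_iff_right hdet.ne_zero]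

theorem Nmat_mul_inv {n : ℕ} {γ θ : ℝ} (h : |γ * Real.cos θ| ≠ 1) :
    Nmat n γ θ * ((1 - ((γ * Real.cos θ : ℝ) : ℂ) ^ 2)⁻¹ • fromBlocks
      ((Complex.I * Complex.exp (-(Complex.I * (θ : ℂ)))) • (1 : Matrix (Fin n) (Fin n) ℂ))
      ((-(Complex.I * ((γ * Real.cos θ : ℝ) : ℂ))) • 1)
      ((-(-(Complex.I * ((γ * Real.cos θ : ℝ) : ℂ)))) • 1)
      ((-(Complex.I * Complex.exp (Complex.I * (θ : ℂ)))) • 1)) = 1 := by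
  have hne : 1 - ((γ * Real.cos θ : ℝ) : ℂ) ^ 2 ≠ 0 := by
    intro h0
    have hsq : (γ * Real.cos θ) ^ 2 = 1 := by exact_mod_cast (sub_eq_zero.1 h0).symm
    exact h ((pow_eq_one_iff_of_nonneg (abs_nonneg _) two_ne_zero).1 ((sq_abs _).trans hsq))
  have hexp : Complex.exp (Complex.I * θ) * Complex.exp (-(Complex.I * θ)) = 1 := by
    rw [← Complex.exp_add, add_neg_cancel, Complex.exp_zero]
  rw [Nmat, mul_smul_comm, fromBlocks_smul_one_mul_adjugate, smul_smul]
  convert one_smul ℂ _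
  rw [inv_mul_eq_one₀ hne]
  linear_combination (Complex.exp (Complex.I * θ) * Complex.exp (-(Complex.I * θ)) -
    ((γ * Real.cos θ : ℝ) : ℂ) ^ 2) * Complex.I_sq - hexp

theorem stmt5 {n : ℕ} (A : Matrix (Fin n) (Fin n) ℂ) (γ θ : ℝ)
    (h : |γ * Real.cos θ| ≠ 1) :
    IsUnit (Nmat n γ θ) ∧
    (Nmat n γ θ)⁻¹ * Mmat A =
      (Complex.I / (1 - ((γ * Real.cos θ : ℝ) : ℂ) ^ 2)) •
        Matrix.fromBlocks
          (Complex.exp (-(Complex.I * (θ : ℂ))) • A)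
          (((γ * Real.cos θ : ℝ) : ℂ) • Aᴴ)
          (((γ * Real.cos θ : ℝ) : ℂ) • A)
          (Complex.exp (Complex.I * (θ : ℂ)) • Aᴴ) ∧
    (∀ lam : ℂ,
      (Mmat A - lam • Nmat n γ θ).det = 0 ↔
        ((Nmat n γ θ)⁻¹ * Mmat A - lam • (1 : Matrix (Fin n ⊕ Fin n) (Fin n ⊕ Fin n) ℂ)).det = 0) := by
  have hmul := Nmat_mul_inv (n := n) h
  have hN : IsUnit (Nmat n γ θ) := .of_mul_eq_one _ hmul
  refine ⟨hN, ?_, det_sub_smul_eq_zero_iff_of_isUnit hN _⟩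
  rw [inv_eq_right_inv hmul, Mmat, smul_mul_assoc, fromBlocks_multiply, div_eq_inv_mul]
  simp [fromBlocks_smul, smul_smul, mul_assoc]
end

section
/- Let A be an n×n complex matrix and γ ∈ ℝ, and define the 2n×2n block matrix S = [[A, −γ·I],[γ·I, −Aᴴ]]. Then det(S) = det(γ²·I − A·Aᴴ); consequently det(S) = 0 (i.e., the pencil (S, T_θ) has zero as an eigenvalue) if and only if γ² is an eigenvalue of A·Aᴴ. -/
open Matrix

/-- `S = [[A, −γ·I],[γ·I, −Aᴴ]]`. -/
noncomputable def Smat {n : ℕ} (A : Matrix (Fin n) (Fin n) ℂ) (γ : ℝ) :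
    Matrix (Fin n ⊕ Fin n) (Fin n ⊕ Fin n) ℂ :=
  Matrix.fromBlocks A ((-(γ : ℂ)) • 1) ((γ : ℂ) • 1) (-Aᴴ)

/-- The determinant of a `2 × 2` block matrix with opposite scalar off-diagonal blocks. -/
theorem det_fromBlocks_neg_smul_one_smul_one {m K : Type*} [Fintype m] [DecidableEq m] [Field K]
    (A D : Matrix m m K) (c : K) :
    (fromBlocks A ((-c) • 1) (c • 1) D).det = (c ^ 2 • (1 : Matrix m m K) + A * D).det := by
  rcases eq_or_ne c 0 with rfl | hc
  · simp
  have hP : (fromBlocks D 1 ((-c) • 1) (0 : Matrix m m K)).det = (c • (1 : Matrix m m K)).det := by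
    have h : fromBlocks D 1 ((-c) • 1) 0 * fromBlocks 1 0 (1 - D) 1 =
        fromBlocks 1 1 ((-c) • 1) (0 : Matrix m m K) := by
      simp [fromBlocks_multiply]
    have hdet := congrArg det h
    rwa [det_mul, det_fromBlocks_zero₁₂, det_one, mul_one, mul_one, det_fromBlocks_one₁₁,
      Matrix.mul_one, zero_sub, ← neg_smul, neg_neg] at hdet
  have hM : fromBlocks A ((-c) • 1) (c • 1) D * fromBlocks D 1 ((-c) • 1) 0 =
      fromBlocks (c ^ 2 • (1 : Matrix m m K) + A * D) A 0 (c • 1) := by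
    simp [fromBlocks_multiply, smul_smul, pow_two, add_comm]
  have hdet := congrArg det hM
  rw [det_mul, hP, det_fromBlocks_zero₂₁] at hdet
  exact mul_right_cancel₀ (by simp [hc]) hdet

theorem stmt9 {n : ℕ} (A : Matrix (Fin n) (Fin n) ℂ) (γ : ℝ) :
    (Smat A γ).det =
      (((γ : ℂ) ^ 2) • (1 : Matrix (Fin n) (Fin n) ℂ) - A * Aᴴ).det ∧
    ((Smat A γ).det = 0 ↔
      (A * Aᴴ - ((γ : ℂ) ^ 2) • (1 : Matrix (Fin n) (Fin n) ℂ)).det = 0) := by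
  have h : (Smat A γ).det =
      (((γ : ℂ) ^ 2) • (1 : Matrix (Fin n) (Fin n) ℂ) - A * Aᴴ).det := by
    rw [Smat, det_fromBlocks_neg_smul_one_smul_one, Matrix.mul_neg, sub_eq_add_neg]
  refine ⟨h, ?_⟩
  rw [h, ← neg_sub, det_neg]
  simp
end

section
/- Let A be an n×n complex matrix and γ, θ ∈ ℝ with γ ≠ 1 and γ ≠ −1. Then T_θ is invertible and T_θ⁻¹·S = (i/(1 − γ²))·[[e^{−iθ}·A − γ²·I, γ·(Aᴴ − e^{−iθ}·I)],[γ·(A − e^{iθ}·I), e^{iθ}·Aᴴ − γ²·I]]; in particular, the spectrum of the matrix pencil (S, T_θ) equals the spectrum of this matrix. -/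
open Matrix

/-- `T_θ = [[−i·e^{iθ}·I, i·γ·I],[−i·γ·I, i·e^{−iθ}·I]]`. -/
noncomputable def Tmat (n : ℕ) (γ θ : ℝ) :
    Matrix (Fin n ⊕ Fin n) (Fin n ⊕ Fin n) ℂ :=
  Matrix.fromBlocks
    ((-(Complex.I * Complex.exp (Complex.I * (θ : ℂ)))) • (1 : Matrix (Fin n) (Fin n) ℂ))
    ((Complex.I * (γ : ℂ)) • (1 : Matrix (Fin n) (Fin n) ℂ))
    ((-(Complex.I * (γ : ℂ))) • (1 : Matrix (Fin n) (Fin n) ℂ))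
    ((Complex.I * Complex.exp (-(Complex.I * (θ : ℂ)))) • (1 : Matrix (Fin n) (Fin n) ℂ))

/-- The explicit inverse of `Tmat n γ θ`. -/
theorem Tmat_mul_inverse (n : ℕ) (γ θ : ℝ) (h : 1 - (γ : ℂ) ^ 2 ≠ 0) :
    Tmat n γ θ * ((Complex.I / (1 - (γ : ℂ) ^ 2)) •
      Matrix.fromBlocks
        (Complex.exp (-(Complex.I * (θ : ℂ))) • (1 : Matrix (Fin n) (Fin n) ℂ))
        ((-(γ : ℂ)) • 1)
        ((γ : ℂ) • 1)
        ((-Complex.exp (Complex.I * (θ : ℂ))) • 1)) = 1 := by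
  have he : Complex.exp (Complex.I * (θ : ℂ)) * Complex.exp (-(Complex.I * (θ : ℂ))) = 1 := by
    rw [← Complex.exp_add, add_neg_cancel, Complex.exp_zero]
  have hI : Complex.I * Complex.I = -1 := Complex.I_mul_I
  rw [Tmat, Matrix.mul_smul, Matrix.fromBlocks_multiply, Matrix.fromBlocks_smul,
    ← Matrix.fromBlocks_one]
  generalize Complex.exp (Complex.I * (θ : ℂ)) = e at *
  generalize Complex.exp (-(Complex.I * (θ : ℂ))) = f at *
  congr 1 <;> simp only [Matrix.smul_mul, Matrix.one_mul, smul_smul, ← add_smul]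
  · convert one_smul ℂ (1 : Matrix (Fin n) (Fin n) ℂ) using 2
    field_simp
    linear_combination (-(e * f) + (γ : ℂ) ^ 2) * hI + he
  · convert zero_smul ℂ (1 : Matrix (Fin n) (Fin n) ℂ) using 2
    ring
  · convert zero_smul ℂ (1 : Matrix (Fin n) (Fin n) ℂ) using 2
    ring
  · convert one_smul ℂ (1 : Matrix (Fin n) (Fin n) ℂ) using 2
    field_simp
    linear_combination (-(e * f) + (γ : ℂ) ^ 2) * hI + he

theorem stmt10 {n : ℕ} (A : Matrix (Fin n) (Fin n) ℂ) (γ θ : ℝ)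
    (h1 : γ ≠ 1) (h2 : γ ≠ -1) :
    IsUnit (Tmat n γ θ) ∧
    (Tmat n γ θ)⁻¹ * Smat A γ =
      (Complex.I / (1 - (γ : ℂ) ^ 2)) •
        Matrix.fromBlocks
          (Complex.exp (-(Complex.I * (θ : ℂ))) • A - ((γ : ℂ) ^ 2) • 1)
          ((γ : ℂ) • (Aᴴ - Complex.exp (-(Complex.I * (θ : ℂ))) • 1))
          ((γ : ℂ) • (A - Complex.exp (Complex.I * (θ : ℂ)) • 1))
          (Complex.exp (Complex.I * (θ : ℂ)) • Aᴴ - ((γ : ℂ) ^ 2) • 1) ∧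
    (∀ lam : ℂ,
      (Smat A γ - lam • Tmat n γ θ).det = 0 ↔
        ((Tmat n γ θ)⁻¹ * Smat A γ -
          lam • (1 : Matrix (Fin n ⊕ Fin n) (Fin n ⊕ Fin n) ℂ)).det = 0) := by
  have hγ : 1 - (γ : ℂ) ^ 2 ≠ 0 := by
    intro h
    have h' : γ ^ 2 = 1 := by exact_mod_cast (sub_eq_zero.mp h).symm
    exact (sq_eq_one_iff.mp h').elim h1 h2
  have hT := Tmat_mul_inverse n γ θ hγ
  have hdet : IsUnit (Tmat n γ θ).det := Matrix.isUnit_det_of_right_inverse hT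
  refine ⟨(Matrix.isUnit_iff_isUnit_det _).mpr hdet, ?_, fun lam => ?_⟩
  · rw [Matrix.inv_eq_right_inv hT, Smat, Matrix.smul_mul, Matrix.fromBlocks_multiply]
    congr 2 <;> simp only [Matrix.smul_mul, Matrix.one_mul] <;> module
  · have hfactor : Smat A γ - lam • Tmat n γ θ =
        Tmat n γ θ * ((Tmat n γ θ)⁻¹ * Smat A γ - lam • 1) := by
      rw [Matrix.mul_sub, Matrix.mul_nonsing_inv_cancel_left _ _ hdet, Matrix.mul_smul,
        Matrix.mul_one]
    rw [hfactor, Matrix.det_mul, mul_eq_zero, or_iff_right hdet.ne_zero]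
end

section
/- Let A be an n×n complex matrix, B an n×m complex matrix, and γ ∈ ℝ with γ ≠ 0, and define the 2n×2n block matrix C = [[A, B̃],[γ·I, −Aᴴ]] with B̃ = (1/γ)·B·Bᴴ − γ·I. Then det(C) = det(γ²·I − A·Aᴴ − B·Bᴴ); consequently det(C) = 0 (i.e., the pencil (C, D_θ) has zero as an eigenvalue) if and only if γ² is an eigenvalue of A·Aᴴ + B·Bᴴ. -/
open Matrix

/-- `B̃ = (1/γ)·B·Bᴴ − γ·I`. -/
noncomputable def Btmat {n m : ℕ} (B : Matrix (Fin n) (Fin m) ℂ) (γ : ℝ) :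
    Matrix (Fin n) (Fin n) ℂ :=
  ((γ : ℂ))⁻¹ • (B * Bᴴ) - (γ : ℂ) • 1

/-- `C = [[A, B̃],[γ·I, −Aᴴ]]`. -/
noncomputable def Cmat {n m : ℕ} (A : Matrix (Fin n) (Fin n) ℂ)
    (B : Matrix (Fin n) (Fin m) ℂ) (γ : ℝ) :
    Matrix (Fin n ⊕ Fin n) (Fin n ⊕ Fin n) ℂ :=
  Matrix.fromBlocks A (Btmat B γ) ((γ : ℂ) • 1) (-Aᴴ)

theorem det_fromBlocks_smul_one₂₁ {n K : Type*} [Fintype n] [DecidableEq n] [Field K]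
    (A X D : Matrix n n K) {c : K} (hc : c ≠ 0) :
    (fromBlocks A X (c • 1) D).det = (A * D - c • X).det := by
  have h : fromBlocks A X (c • 1) D * fromBlocks 1 (c⁻¹ • (1 - D)) 0 1 =
      fromBlocks A (c⁻¹ • (A - A * D) + X) (c • 1) 1 := by
    simp [fromBlocks_multiply, mul_sub, smul_sub, inv_smul_smul₀ hc]
  have hdet := congrArg det h
  rw [det_mul, det_fromBlocks_zero₂₁, det_one, one_mul, mul_one, det_fromBlocks_one₂₂] at hdet
  rw [hdet]
  congr 1
  simp only [Matrix.mul_smul, Matrix.mul_one, smul_add, smul_smul, mul_inv_cancel₀ hc, one_smul]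
  abel

theorem stmt15 {n m : ℕ} (A : Matrix (Fin n) (Fin n) ℂ) (B : Matrix (Fin n) (Fin m) ℂ)
    (γ : ℝ) (hγ : γ ≠ 0) :
    (Cmat A B γ).det =
      (((γ : ℂ) ^ 2) • (1 : Matrix (Fin n) (Fin n) ℂ) - A * Aᴴ - B * Bᴴ).det ∧
    ((Cmat A B γ).det = 0 ↔
      (A * Aᴴ + B * Bᴴ - ((γ : ℂ) ^ 2) • (1 : Matrix (Fin n) (Fin n) ℂ)).det = 0) := by
  have hc : (γ : ℂ) ≠ 0 := Complex.ofReal_ne_zero.mpr hγ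
  have hdet : (Cmat A B γ).det =
      (((γ : ℂ) ^ 2) • (1 : Matrix (Fin n) (Fin n) ℂ) - A * Aᴴ - B * Bᴴ).det := by
    rw [Cmat, det_fromBlocks_smul_one₂₁ _ _ _ hc, Btmat]
    congr 1
    simp only [smul_sub, smul_smul, mul_inv_cancel₀ hc, one_smul, Matrix.mul_neg, ← pow_two]
    abel
  refine ⟨hdet, ?_⟩
  have hneg : ((γ : ℂ) ^ 2) • (1 : Matrix (Fin n) (Fin n) ℂ) - A * Aᴴ - B * Bᴴ =
      -(A * Aᴴ + B * Bᴴ - ((γ : ℂ) ^ 2) • 1) := by abel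
  rw [hdet, hneg, det_neg]
  simp
end
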